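/- For 0 < p ≤ 1, the map Ψ_p(A) = Tr((Tr_2 A^p)^{1/p}) is concave on positive semidefinite matrices indexed by I×J: for positive semidefinite A, B indexed by I×J and t ∈ [0,1], Ψ_p(t·A + (1−t)·B) ≥ t·Ψ_p(A) + (1−t)·Ψ_p(B). -/

import Mathlib

open Matrix
open scoped ComplexOrder

/-- Matrix power via the functional calculus: for a Hermitian matrix, apply the real
power `x ^ s` to the eigenvalues in its spectral decomposition (so `0 ^ s = 0` for `s > 0`);
junk value `0` for non-Hermitian matrices. -/
noncomputable def matrixRpow {n : Type*} [Fintype n] [DecidableEq n]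
    (A : Matrix n n ℂ) (s : ℝ) : Matrix n n ℂ :=
  if h : A.IsHermitian then
    (h.eigenvectorUnitary : Matrix n n ℂ) *
      Matrix.diagonal (fun i => ((h.eigenvalues i ^ s : ℝ) : ℂ)) *
        (star h.eigenvectorUnitary : Matrix n n ℂ)
  else 0

/-- Partial trace over the second factor: `(Tr₂ A)(i,i') = ∑ j, A((i,j),(i',j))`. -/
noncomputable def ptraceSnd {I J : Type*} [Fintype J]
    (A : Matrix (I × J) (I × J) ℂ) : Matrix I I ℂ :=
  Matrix.of fun i i' => ∑ j, A (i, j) (i', j)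

/-- `Ψ_p(A) = Tr((Tr₂ A^p)^{1/p})`. -/
noncomputable def Psi {I J : Type*} [Fintype I] [Fintype J] [DecidableEq I] [DecidableEq J]
    (p : ℝ) (A : Matrix (I × J) (I × J) ℂ) : ℝ :=
  (matrixRpow (ptraceSnd (matrixRpow A p)) (1 / p)).trace.re


namespace Matrix

theorem PosSemidef.combo {m : Type*} {A B : Matrix m m ℂ} (hA : A.PosSemidef)
    (hB : B.PosSemidef) {a b : ℝ} (ha : 0 ≤ a) (hb : 0 ≤ b) : (a • A + b • B).PosSemidef :=
  (hA.smul ha).add (hB.smul hb)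

variable {n : Type*} [Fintype n] [DecidableEq n]

theorem matrixRpow_eq_cfc {A : Matrix n n ℂ} (hA : A.IsHermitian) (s : ℝ) :
    matrixRpow A s = cfc (fun x : ℝ => x ^ s) A := by
  rw [hA.cfc_eq, IsHermitian.cfc, Unitary.conjStarAlgAut_apply, matrixRpow, dif_pos hA]
  rfl

theorem re_trace_diagonal_mul_diagonal (x y : n → ℝ) (M : Matrix n n ℂ) :
    (diagonal (fun i => (x i : ℂ)) * M * diagonal (fun i => (y i : ℂ)) * Mᴴ).trace.re =
      ∑ i, ∑ j, x i * y j * Complex.normSq (M i j) := by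
  simp only [trace, diag_apply, Complex.re_sum]
  refine Finset.sum_congr rfl fun i _ => ?_
  rw [mul_apply, Complex.re_sum]
  refine Finset.sum_congr rfl fun j _ => ?_
  rw [mul_diagonal, diagonal_mul, conjTranspose_apply, Complex.normSq_apply]
  simp
  ring

/-- The squared moduli of the inner products between the eigenvectors of two Hermitian matrices. -/
noncomputable def overlap {A B : Matrix n n ℂ} (hA : A.IsHermitian) (hB : B.IsHermitian)
    (i j : n) : ℝ :=
  Complex.normSq (((hA.eigenvectorUnitary : Matrix n n ℂ)ᴴ * hB.eigenvectorUnitary) i j)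

theorem overlap_nonneg {A B : Matrix n n ℂ} (hA : A.IsHermitian) (hB : B.IsHermitian) (i j : n) :
    0 ≤ overlap hA hB i j :=
  Complex.normSq_nonneg _

theorem cfc_eq_mul_diagonal_mul {A : Matrix n n ℂ} (hA : A.IsHermitian) (f : ℝ → ℝ) :
    cfc f A = (hA.eigenvectorUnitary : Matrix n n ℂ) *
      diagonal (fun i => (f (hA.eigenvalues i) : ℂ)) *
        (hA.eigenvectorUnitary : Matrix n n ℂ)ᴴ := by
  rw [hA.cfc_eq, IsHermitian.cfc, Unitary.conjStarAlgAut_apply]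
  rfl

theorem re_trace_cfc_mul_cfc {A B : Matrix n n ℂ} (hA : A.IsHermitian) (hB : B.IsHermitian)
    (f g : ℝ → ℝ) :
    (cfc f A * cfc g B).trace.re =
      ∑ i, ∑ j, f (hA.eigenvalues i) * g (hB.eigenvalues j) * overlap hA hB i j := by
  rw [cfc_eq_mul_diagonal_mul hA, cfc_eq_mul_diagonal_mul hB]
  unfold overlap
  rw [← re_trace_diagonal_mul_diagonal (fun i => f (hA.eigenvalues i))
    (fun j => g (hB.eigenvalues j)), conjTranspose_mul, conjTranspose_conjTranspose]
  simp only [Matrix.mul_assoc]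
  rw [trace_mul_comm]
  simp only [Matrix.mul_assoc]

theorem cfc_one_fun {A : Matrix n n ℂ} (hA : A.IsHermitian) : cfc (fun _ : ℝ => (1 : ℝ)) A = 1 :=
  cfc_const_one ℝ A hA.isSelfAdjoint

theorem cfc_id_fun {A : Matrix n n ℂ} (hA : A.IsHermitian) : cfc (fun x : ℝ => x) A = A :=
  cfc_id' ℝ A hA.isSelfAdjoint

theorem eigenvectorUnitary_conjTranspose_mul {A : Matrix n n ℂ} (hA : A.IsHermitian) :
    (hA.eigenvectorUnitary : Matrix n n ℂ)ᴴ * hA.eigenvectorUnitary = 1 :=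
  Unitary.coe_star_mul_self hA.eigenvectorUnitary

theorem eigenvectorUnitary_mul_conjTranspose {A : Matrix n n ℂ} (hA : A.IsHermitian) :
    (hA.eigenvectorUnitary : Matrix n n ℂ) * (hA.eigenvectorUnitary : Matrix n n ℂ)ᴴ = 1 :=
  Unitary.coe_mul_star_self hA.eigenvectorUnitary

/-- The quadratic form whose infimum over `W` is the parallel sum of left multiplication by `A`
and right multiplication by `s • B`, evaluated at the identity. -/
noncomputable def parallelForm (s : ℝ) (A B W : Matrix n n ℂ) : ℝ :=
  ((1 - W)ᴴ * A * (1 - W)).trace.re + s * (W * B * Wᴴ).trace.re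

theorem parallelForm_combo (s a b : ℝ) (A₁ A₂ B₁ B₂ W : Matrix n n ℂ) :
    parallelForm s (a • A₁ + b • A₂) (a • B₁ + b • B₂) W =
      a * parallelForm s A₁ B₁ W + b * parallelForm s A₂ B₂ W := by
  simp only [parallelForm, Matrix.mul_add, Matrix.add_mul, Matrix.mul_smul, Matrix.smul_mul,
    trace_add, trace_smul, Complex.add_re, Complex.smul_re, smul_eq_mul]
  ring

theorem parallelForm_eq_sum {A B : Matrix n n ℂ} (hA : A.IsHermitian) (hB : B.IsHermitian)
    (s : ℝ) (M : Matrix n n ℂ) :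
    parallelForm s A B ((hA.eigenvectorUnitary : Matrix n n ℂ) * M *
        (hB.eigenvectorUnitary : Matrix n n ℂ)ᴴ) =
      ∑ i, ∑ j, (hA.eigenvalues i * Complex.normSq
          ((((hA.eigenvectorUnitary : Matrix n n ℂ)ᴴ * hB.eigenvectorUnitary) - M) i j) +
        s * hB.eigenvalues j * Complex.normSq (M i j)) := by
  have hU := eigenvectorUnitary_conjTranspose_mul hA
  have hU' := eigenvectorUnitary_mul_conjTranspose hA
  have hV := eigenvectorUnitary_conjTranspose_mul hB
  have hV' := eigenvectorUnitary_mul_conjTranspose hB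
  have hAs := (cfc_id_fun hA).symm.trans (cfc_eq_mul_diagonal_mul hA _)
  have hBs := (cfc_id_fun hB).symm.trans (cfc_eq_mul_diagonal_mul hB _)
  have e₁ := re_trace_diagonal_mul_diagonal hA.eigenvalues 1
    ((hA.eigenvectorUnitary : Matrix n n ℂ)ᴴ * hB.eigenvectorUnitary - M)
  have e₂ := re_trace_diagonal_mul_diagonal 1 hB.eigenvalues M
  simp only [Pi.one_apply, Complex.ofReal_one, diagonal_one,
    mul_one, one_mul] at e₁ e₂
  simp only [Finset.sum_add_distrib, mul_assoc s, ← Finset.mul_sum _ _ s]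
  rw [← e₁, ← e₂]
  unfold parallelForm
  generalize (hA.eigenvectorUnitary : Matrix n n ℂ) = U at *
  generalize (hB.eigenvectorUnitary : Matrix n n ℂ) = V at *
  generalize hD : diagonal (fun i => (hA.eigenvalues i : ℂ)) = D at *
  generalize hE : diagonal (fun i => (hB.eigenvalues i : ℂ)) = E at *
  have h1 : 1 - U * M * Vᴴ = U * (Uᴴ * V - M) * Vᴴ := by
    rw [Matrix.mul_sub, Matrix.sub_mul, ← Matrix.mul_assoc U, hU', Matrix.one_mul, hV']
  have h2 : (1 - U * M * Vᴴ)ᴴ * A * (1 - U * M * Vᴴ) =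
      V * ((Uᴴ * V - M)ᴴ * D * (Uᴴ * V - M) * Vᴴ) := by
    rw [h1]
    generalize Uᴴ * V - M = N
    rw [hAs]
    simp only [conjTranspose_mul, conjTranspose_conjTranspose]
    calc _ = V * Nᴴ * (Uᴴ * U) * D * (Uᴴ * U) * N * Vᴴ := by simp only [Matrix.mul_assoc]
      _ = _ := by rw [hU]; simp only [Matrix.mul_assoc, Matrix.mul_one]
  have h3 : U * M * Vᴴ * B * (U * M * Vᴴ)ᴴ = U * (M * E * Mᴴ * Uᴴ) := by
    rw [hBs]
    simp only [conjTranspose_mul, conjTranspose_conjTranspose]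
    calc _ = U * M * (Vᴴ * V) * E * (Vᴴ * V) * Mᴴ * Uᴴ := by simp only [Matrix.mul_assoc]
      _ = _ := by rw [hV]; simp only [Matrix.mul_assoc, Matrix.mul_one]
  rw [h2, h3, trace_mul_comm, trace_mul_comm U, Matrix.mul_assoc _ Vᴴ, hV, Matrix.mul_assoc _ Uᴴ,
    hU, Matrix.mul_one, Matrix.mul_one, Matrix.mul_assoc, trace_mul_comm]

/-- The value of the parallel sum of left multiplication by `A` and right multiplication by
`s • B` at the identity, computed in eigenbases. -/
noncomputable def parallelSum {A B : Matrix n n ℂ} (hA : A.IsHermitian) (hB : B.IsHermitian)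
    (s : ℝ) : ℝ :=
  ∑ i, ∑ j, hA.eigenvalues i * (s * hB.eigenvalues j) /
    (hA.eigenvalues i + s * hB.eigenvalues j) * overlap hA hB i j

theorem parallel_mul_normSq_le {x y : ℝ} (hx : 0 ≤ x) (hy : 0 ≤ y) (u m : ℂ) :
    x * y / (x + y) * Complex.normSq u ≤ x * Complex.normSq (u - m) + y * Complex.normSq m := by
  rcases (add_nonneg hx hy).eq_or_lt with h | h
  · rw [← h, div_zero, zero_mul]
    exact add_nonneg (mul_nonneg hx (Complex.normSq_nonneg _))
      (mul_nonneg hy (Complex.normSq_nonneg _))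
  · rw [div_mul_eq_mul_div, div_le_iff₀ h]
    simp only [Complex.normSq_apply, Complex.sub_re, Complex.sub_im]
    nlinarith [sq_nonneg (x * u.re - (x + y) * m.re), sq_nonneg (x * u.im - (x + y) * m.im)]

theorem parallel_mul_normSq_eq {x y : ℝ} (hx : 0 ≤ x) (hy : 0 ≤ y) (u : ℂ) :
    x * Complex.normSq (u - (x / (x + y) : ℝ) * u) + y * Complex.normSq ((x / (x + y) : ℝ) * u) =
      x * y / (x + y) * Complex.normSq u := by
  have e : u - (x / (x + y) : ℝ) * u = ((1 - x / (x + y) : ℝ) : ℂ) * u := by push_cast; ring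
  rw [e, Complex.normSq_mul, Complex.normSq_mul, Complex.normSq_ofReal, Complex.normSq_ofReal]
  rcases (add_nonneg hx hy).eq_or_lt with h | h
  · have hx0 : x = 0 := by linarith
    simp [hx0]
  · field_simp
    ring

theorem parallelSum_le_parallelForm {A B : Matrix n n ℂ} (hA : A.PosSemidef) (hB : B.PosSemidef)
    {s : ℝ} (hs : 0 ≤ s) (W : Matrix n n ℂ) :
    parallelSum hA.isHermitian hB.isHermitian s ≤ parallelForm s A B W := by
  have hW : W = (hA.isHermitian.eigenvectorUnitary : Matrix n n ℂ) *
      ((hA.isHermitian.eigenvectorUnitary : Matrix n n ℂ)ᴴ * W *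
        hB.isHermitian.eigenvectorUnitary) *
      (hB.isHermitian.eigenvectorUnitary : Matrix n n ℂ)ᴴ := by
    rw [← Matrix.mul_assoc, ← Matrix.mul_assoc, eigenvectorUnitary_mul_conjTranspose,
      Matrix.one_mul, Matrix.mul_assoc, eigenvectorUnitary_mul_conjTranspose, Matrix.mul_one]
  rw [hW, parallelForm_eq_sum]
  exact Finset.sum_le_sum fun i _ => Finset.sum_le_sum fun j _ =>
    parallel_mul_normSq_le (hA.eigenvalues_nonneg i) (mul_nonneg hs (hB.eigenvalues_nonneg j)) _ _

theorem exists_parallelForm_eq {A B : Matrix n n ℂ} (hA : A.PosSemidef) (hB : B.PosSemidef)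
    {s : ℝ} (hs : 0 ≤ s) :
    ∃ W, parallelForm s A B W = parallelSum hA.isHermitian hB.isHermitian s := by
  refine ⟨_, (parallelForm_eq_sum hA.isHermitian hB.isHermitian s (of fun i j =>
    ((hA.isHermitian.eigenvalues i / (hA.isHermitian.eigenvalues i +
      s * hB.isHermitian.eigenvalues j) : ℝ) : ℂ) *
      ((hA.isHermitian.eigenvectorUnitary : Matrix n n ℂ)ᴴ *
        hB.isHermitian.eigenvectorUnitary) i j)).trans ?_⟩
  exact Finset.sum_congr rfl fun i _ => Finset.sum_congr rfl fun j _ =>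
    parallel_mul_normSq_eq (hA.eigenvalues_nonneg i) (mul_nonneg hs (hB.eigenvalues_nonneg j)) _

theorem parallelSum_concave {A₁ A₂ B₁ B₂ : Matrix n n ℂ} (hA₁ : A₁.PosSemidef)
    (hA₂ : A₂.PosSemidef) (hB₁ : B₁.PosSemidef) (hB₂ : B₂.PosSemidef) {a b s : ℝ} (ha : 0 ≤ a)
    (hb : 0 ≤ b) (hs : 0 ≤ s) :
    a * parallelSum hA₁.isHermitian hB₁.isHermitian s +
        b * parallelSum hA₂.isHermitian hB₂.isHermitian s ≤
      parallelSum (hA₁.combo hA₂ ha hb).isHermitian (hB₁.combo hB₂ ha hb).isHermitian s := by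
  obtain ⟨W, hW⟩ := exists_parallelForm_eq (hA₁.combo hA₂ ha hb) (hB₁.combo hB₂ ha hb) hs
  rw [← hW, parallelForm_combo]
  exact add_le_add (mul_le_mul_of_nonneg_left (parallelSum_le_parallelForm hA₁ hB₁ hs W) ha)
    (mul_le_mul_of_nonneg_left (parallelSum_le_parallelForm hA₂ hB₂ hs W) hb)

open MeasureTheory Set in
theorem _root_.Real.rpow_mul_rpow_one_sub_eq_integral {p : ℝ} (hp : p ∈ Ioo 0 1) {a b : ℝ}
    (ha : 0 ≤ a) (hb : 0 ≤ b) :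
    IntegrableOn (fun t : ℝ => t ^ (p - 2) * (a * (t * b) / (a + t * b))) (Ioi 0) ∧
      a ^ p * b ^ (1 - p) = (∫ t in Ioi 0, Real.rpowIntegrand₀₁ p t 1)⁻¹ *
        ∫ t in Ioi 0, t ^ (p - 2) * (a * (t * b) / (a + t * b)) := by
  have key : EqOn (fun t => b * Real.rpowIntegrand₀₁ p t (a / b))
      (fun t : ℝ => t ^ (p - 2) * (a * (t * b) / (a + t * b))) (Ioi 0) := by
    intro t ht
    have ht' : 0 < t := ht
    rcases hb.eq_or_lt with rfl | hb'
    · simp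
    · have e : t ^ (p - 1) = t ^ (p - 2) * t := by
        rw [← Real.rpow_add_one ht'.ne']; ring_nf
      have h1 : 0 < t * b + a := by positivity
      have h2 : 0 < a + t * b := by positivity
      simp only
      rw [Real.rpowIntegrand₀₁_eq_pow_div hp ht'.le (by positivity), e]
      field_simp
      ring
  have hab : 0 ≤ a / b := div_nonneg ha hb
  refine ⟨IntegrableOn.congr_fun ((Real.integrableOn_rpowIntegrand₀₁_Ioi hp hab).const_mul b) key
    measurableSet_Ioi, ?_⟩
  rw [← setIntegral_congr_fun measurableSet_Ioi key, integral_const_mul, mul_left_comm,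
    ← Real.rpow_eq_const_mul_integral hp hab]
  rcases hb.eq_or_lt with rfl | hb'
  · rw [Real.zero_rpow (by linarith [hp.2])]; simp
  · rw [Real.div_rpow ha hb, Real.rpow_sub hb', Real.rpow_one]
    have := (Real.rpow_pos_of_pos hb' p).ne'
    field_simp

open MeasureTheory Set in
theorem re_trace_rpow_mul_rpow_eq_integral {p : ℝ} (hp : p ∈ Ioo 0 1) {A B : Matrix n n ℂ}
    (hA : A.PosSemidef) (hB : B.PosSemidef) :
    IntegrableOn (fun t : ℝ => t ^ (p - 2) * parallelSum hA.isHermitian hB.isHermitian t) (Ioi 0) ∧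
      (matrixRpow A p * matrixRpow B (1 - p)).trace.re =
        (∫ t in Ioi 0, Real.rpowIntegrand₀₁ p t 1)⁻¹ *
          ∫ t in Ioi 0, t ^ (p - 2) * parallelSum hA.isHermitian hB.isHermitian t := by
  have h i j := Real.rpow_mul_rpow_one_sub_eq_integral hp (hA.eigenvalues_nonneg i)
    (hB.eigenvalues_nonneg j)
  have hint i j := (h i j).1.mul_const (overlap hA.isHermitian hB.isHermitian i j)
  simp only [parallelSum, Finset.mul_sum, ← mul_assoc] at h hint ⊢
  refine ⟨integrable_finsetSum _ fun i _ => integrable_finsetSum _ fun j _ => ?_, ?_⟩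
  · simpa only [mul_assoc, mul_div_assoc] using hint i j
  · rw [matrixRpow_eq_cfc hA.isHermitian, matrixRpow_eq_cfc hB.isHermitian,
      re_trace_cfc_mul_cfc hA.isHermitian hB.isHermitian, integral_finsetSum]
    · rw [Finset.mul_sum]
      refine Finset.sum_congr rfl fun i _ => ?_
      rw [integral_finsetSum]
      · rw [Finset.mul_sum]
        refine Finset.sum_congr rfl fun j _ => ?_
        rw [(h i j).2, mul_assoc, ← integral_mul_const]
      · exact fun j _ => hint i j
    · exact fun i _ => integrable_finsetSum _ fun j _ => hint i j

/-- Lieb's joint concavity of `(A, B) ↦ Tr (A ^ p * B ^ (1 - p))`. -/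
theorem re_trace_rpow_mul_rpow_concave {p : ℝ} (hp : p ∈ Set.Ioo 0 1) {A₁ A₂ B₁ B₂ : Matrix n n ℂ}
    (hA₁ : A₁.PosSemidef) (hA₂ : A₂.PosSemidef) (hB₁ : B₁.PosSemidef) (hB₂ : B₂.PosSemidef)
    {a b : ℝ} (ha : 0 ≤ a) (hb : 0 ≤ b) :
    a * (matrixRpow A₁ p * matrixRpow B₁ (1 - p)).trace.re +
        b * (matrixRpow A₂ p * matrixRpow B₂ (1 - p)).trace.re ≤
      (matrixRpow (a • A₁ + b • A₂) p * matrixRpow (a • B₁ + b • B₂) (1 - p)).trace.re := by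
  obtain ⟨i₁, e₁⟩ := re_trace_rpow_mul_rpow_eq_integral hp hA₁ hB₁
  obtain ⟨i₂, e₂⟩ := re_trace_rpow_mul_rpow_eq_integral hp hA₂ hB₂
  obtain ⟨i₃, e₃⟩ := re_trace_rpow_mul_rpow_eq_integral hp (hA₁.combo hA₂ ha hb)
    (hB₁.combo hB₂ ha hb)
  rw [e₁, e₂, e₃, mul_left_comm, mul_left_comm b, ← mul_add]
  refine mul_le_mul_of_nonneg_left ?_ (inv_nonneg.2 (Real.integral_rpowIntegrand₀₁_one_pos hp).le)
  rw [← MeasureTheory.integral_const_mul, ← MeasureTheory.integral_const_mul,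
    ← MeasureTheory.integral_add (i₁.const_mul a) (i₂.const_mul b)]
  refine MeasureTheory.setIntegral_mono_on ((i₁.const_mul a).add (i₂.const_mul b)) i₃
    measurableSet_Ioi fun t ht => ?_
  have ht' : 0 < t := ht
  rw [mul_left_comm, mul_left_comm b, ← mul_add]
  exact mul_le_mul_of_nonneg_left (parallelSum_concave hA₁ hA₂ hB₁ hB₂ ha hb ht'.le)
    (Real.rpow_nonneg ht'.le _)

theorem PosSemidef.matrixRpow {A : Matrix n n ℂ} (hA : A.PosSemidef) (s : ℝ) :
    (matrixRpow A s).PosSemidef := by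
  rw [matrixRpow_eq_cfc hA.isHermitian, cfc_eq_mul_diagonal_mul hA.isHermitian]
  refine PosSemidef.mul_mul_conjTranspose_same (.diagonal fun i => ?_) _
  exact Complex.zero_le_real.2 (Real.rpow_nonneg (hA.eigenvalues_nonneg i) s)

theorem matrixRpow_one {A : Matrix n n ℂ} (hA : A.IsHermitian) : matrixRpow A 1 = A := by
  simpa only [matrixRpow_eq_cfc hA, Real.rpow_one] using cfc_id_fun hA

/-- Young's inequality for traces. -/
theorem re_trace_mul_rpow_le {p : ℝ} (hp : p ∈ Set.Ioo 0 1) {X Z : Matrix n n ℂ}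
    (hX : X.PosSemidef) (hZ : Z.PosSemidef) :
    (X * matrixRpow Z (1 - p)).trace.re ≤
      p * (matrixRpow X (1 / p)).trace.re + (1 - p) * Z.trace.re := by
  have h₁ := re_trace_cfc_mul_cfc hX.isHermitian hZ.isHermitian (fun x => x) (fun z => z ^ (1 - p))
  have h₂ := re_trace_cfc_mul_cfc hX.isHermitian hZ.isHermitian (fun x => x ^ (1 / p)) (fun _ => 1)
  have h₃ := re_trace_cfc_mul_cfc hX.isHermitian hZ.isHermitian (fun _ => 1) (fun z => z)
  rw [cfc_id_fun hX.isHermitian, ← matrixRpow_eq_cfc hZ.isHermitian] at h₁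
  rw [cfc_one_fun hZ.isHermitian, ← matrixRpow_eq_cfc hX.isHermitian, Matrix.mul_one] at h₂
  rw [cfc_one_fun hX.isHermitian, cfc_id_fun hZ.isHermitian, Matrix.one_mul] at h₃
  rw [h₁, h₂, h₃]
  simp only [Finset.mul_sum, ← Finset.sum_add_distrib]
  refine Finset.sum_le_sum fun i _ => Finset.sum_le_sum fun j _ => ?_
  have hx := hX.eigenvalues_nonneg i
  have hz := hZ.eigenvalues_nonneg j
  have key := Real.geom_mean_le_arith_mean2_weighted hp.1.le (sub_nonneg.2 hp.2.le)
    (Real.rpow_nonneg hx (1 / p)) hz (by ring)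
  rw [← Real.rpow_mul hx, one_div_mul_cancel hp.1.ne', Real.rpow_one] at key
  have := mul_le_mul_of_nonneg_right key (overlap_nonneg hX.isHermitian hZ.isHermitian i j)
  linarith

theorem mul_rpow_rpow_eq {p : ℝ} (hp : p ∈ Set.Ioo 0 1) {X : Matrix n n ℂ} (hX : X.PosSemidef) :
    X * matrixRpow (matrixRpow X (1 / p)) (1 - p) = matrixRpow X (1 / p) := by
  have hc (f : ℝ → ℝ) (s : Set ℝ) (hs : s.Finite) : ContinuousOn f s := hs.continuousOn f
  have hfin := X.finite_real_spectrum
  have hsa := hX.isHermitian.isSelfAdjoint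
  rw [matrixRpow_eq_cfc (hX.matrixRpow _).isHermitian, matrixRpow_eq_cfc hX.isHermitian,
    ← cfc_comp' _ _ X (hc _ _ (hfin.image _)) (hc _ _ hfin) hsa]
  conv_lhs => enter [1]; rw [← cfc_id_fun hX.isHermitian]
  rw [← cfc_mul _ _ X (hc _ _ hfin) (hc _ _ hfin)]
  refine cfc_congr fun x hx => ?_
  rw [hX.isHermitian.spectrum_real_eq_range_eigenvalues] at hx
  obtain ⟨i, rfl⟩ := hx
  have h0 := hX.eigenvalues_nonneg i
  have hp0 := hp.1
  have hp1 := hp.2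
  have e : 1 / p = 1 + 1 / p * (1 - p) := by field_simp; ring
  have hne : 1 + 1 / p * (1 - p) ≠ 0 := by rw [← e]; positivity
  conv_rhs => rw [e]
  rw [← Real.rpow_mul h0, Real.rpow_add' h0 hne, Real.rpow_one]

section PartialTrace

variable {I J : Type*} [Fintype I] [Fintype J] [DecidableEq J]

open scoped Kronecker

theorem PosSemidef.ptraceSnd {I J : Type*} [Fintype J] {M : Matrix (I × J) (I × J) ℂ}
    (hM : M.PosSemidef) : (ptraceSnd M).PosSemidef := by
  have e : _root_.ptraceSnd M = ∑ j, M.submatrix (fun i => (i, j)) (fun i => (i, j)) := by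
    ext i i'
    simp [_root_.ptraceSnd, Matrix.sum_apply]
  rw [e]
  exact posSemidef_sum _ fun j _ => hM.submatrix _

theorem trace_ptraceSnd_mul (M : Matrix (I × J) (I × J) ℂ) (Z : Matrix I I ℂ) :
    (ptraceSnd M * Z).trace = (M * (Z ⊗ₖ (1 : Matrix J J ℂ))).trace := by
  simp only [trace, diag_apply, mul_apply, ptraceSnd, of_apply, Fintype.sum_prod_type,
    kroneckerMap_apply, one_apply, mul_ite, mul_one, mul_zero, Finset.sum_ite_eq',
    Finset.mem_univ, if_true, Finset.sum_mul]
  exact Finset.sum_congr rfl fun i _ => Finset.sum_comm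

/-- The ampliation `Z ↦ Z ⊗ 1` as a star algebra homomorphism. -/
noncomputable def kroneckerOne (I J : Type*) [Fintype I] [Fintype J] [DecidableEq I]
    [DecidableEq J] : Matrix I I ℂ →⋆ₐ[ℂ] Matrix (I × J) (I × J) ℂ where
  toFun Z := Z ⊗ₖ (1 : Matrix J J ℂ)
  map_one' := one_kronecker_one
  map_mul' X Y := by rw [← mul_kronecker_mul, Matrix.mul_one]
  map_zero' := zero_kronecker _
  map_add' X Y := add_kronecker X Y _
  commutes' c := by
    rw [Algebra.algebraMap_eq_smul_one, Algebra.algebraMap_eq_smul_one, smul_kronecker,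
      one_kronecker_one]
  map_star' X := by
    simp only [star_eq_conjTranspose, conjTranspose_kronecker, conjTranspose_one]

theorem matrixRpow_kronecker_one [DecidableEq I] {Z : Matrix I I ℂ} (hZ : Z.PosSemidef) (s : ℝ) :
    matrixRpow (Z ⊗ₖ (1 : Matrix J J ℂ)) s = matrixRpow Z s ⊗ₖ (1 : Matrix J J ℂ) := by
  have hK : (Z ⊗ₖ (1 : Matrix J J ℂ)).PosSemidef := hZ.kronecker .one
  rw [matrixRpow_eq_cfc hK.isHermitian, matrixRpow_eq_cfc hZ.isHermitian]
  exact (StarAlgHom.map_cfc (kroneckerOne I J) _ Z (Z.finite_real_spectrum.continuousOn _)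
    (kroneckerOne I J).toAlgHom.toLinearMap.continuous_of_finiteDimensional
    hZ.isHermitian.isSelfAdjoint hK.isHermitian.isSelfAdjoint).symm

end PartialTrace

end Matrix

/-- **Concavity of `Ψ_p` for `0 < p ≤ 1`:** the map
`A ↦ Tr((Tr₂ A^p)^{1/p})` is concave on positive semidefinite matrices indexed by `I × J`. -/
theorem Psi_concave {I J : Type*} [Fintype I] [Fintype J] [DecidableEq I] [DecidableEq J]
    (p : ℝ) (hp0 : 0 < p) (hp1 : p ≤ 1)
    (A B : Matrix (I × J) (I × J) ℂ) (hA : A.PosSemidef) (hB : B.PosSemidef)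
    (t : ℝ) (ht0 : 0 ≤ t) (ht1 : t ≤ 1) :
    t * Psi p A + (1 - t) * Psi p B ≤ Psi p (t • A + (1 - t) • B) := by
  have ht1' : 0 ≤ 1 - t := sub_nonneg.2 ht1
  have hC := hA.combo hB ht0 ht1'
  rcases hp1.eq_or_lt with rfl | hp1
  · have hPsi {M : Matrix (I × J) (I × J) ℂ} (hM : M.PosSemidef) : Psi 1 M = M.trace.re := by
      rw [Psi, one_div_one, matrixRpow_one hM.isHermitian, matrixRpow_one hM.ptraceSnd.isHermitian]
      simpa using congrArg Complex.re (trace_ptraceSnd_mul M 1)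
    rw [hPsi hA, hPsi hB, hPsi hC]
    simp [trace_add, trace_smul]
  · have hp : p ∈ Set.Ioo 0 1 := ⟨hp0, hp1⟩
    have hX := (hA.matrixRpow p).ptraceSnd
    have hY := (hB.matrixRpow p).ptraceSnd
    have hZX := hX.matrixRpow (1 / p)
    have hZY := hY.matrixRpow (1 / p)
    have hZ := hZX.combo hZY ht0 ht1'
    have hyoung := re_trace_mul_rpow_le hp (hC.matrixRpow p).ptraceSnd hZ
    have hlieb := re_trace_rpow_mul_rpow_concave hp hA hB
      (hZX.kronecker (.one (n := J))) (hZY.kronecker (.one (n := J))) ht0 ht1'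
    rw [← smul_kronecker, ← smul_kronecker, ← add_kronecker, matrixRpow_kronecker_one hZX,
      matrixRpow_kronecker_one hZY, matrixRpow_kronecker_one hZ, ← trace_ptraceSnd_mul,
      ← trace_ptraceSnd_mul, ← trace_ptraceSnd_mul, mul_rpow_rpow_eq hp hX,
      mul_rpow_rpow_eq hp hY] at hlieb
    simp only [trace_add, trace_smul, Complex.add_re, Complex.smul_re, smul_eq_mul] at hyoung
    refine le_of_mul_le_mul_left ?_ hp0
    simp only [Psi]
    linarith
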